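/- arXiv:1612.01821 — 3 statements merged into one kernel-verified Lean document; each statement's English description precedes it below -/
import Mathlib

section
/- Let q be a nonzero complex number. The algebra SL_q(2) is a Hopf algebra: there exist unique algebra morphisms Δ : SL_q(2) → SL_q(2) ⊗ SL_q(2) and ε : SL_q(2) → ℂ with Δ(a) = a⊗a + b⊗c, Δ(b) = a⊗b + b⊗d, Δ(c) = c⊗a + d⊗c, Δ(d) = c⊗b + d⊗d, ε(a) = ε(d) = 1, ε(b) = ε(c) = 0; Δ is coassociative, ε is a counit for Δ; and there exists a linear map S : SL_q(2) → SL_q(2) with S(a) = d, S(b) = −qb, S(c) = −q⁻¹c, S(d) = a satisfying the antipode equations μ∘(S⊗id)∘Δ = η∘ε = μ∘(id⊗S)∘Δ. -/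
open TensorProduct

/-- The defining relations of `SL_q(2)` on the free algebra over `ℂ` on four generators
`a = ι 0`, `b = ι 1`, `c = ι 2`, `d = ι 3`. -/
inductive SLqRel (q : ℂ) : FreeAlgebra ℂ (Fin 4) → FreeAlgebra ℂ (Fin 4) → Prop
  | ba : SLqRel q (FreeAlgebra.ι ℂ 1 * FreeAlgebra.ι ℂ 0)
      (q • (FreeAlgebra.ι ℂ 0 * FreeAlgebra.ι ℂ 1))
  | ca : SLqRel q (FreeAlgebra.ι ℂ 2 * FreeAlgebra.ι ℂ 0)
      (q • (FreeAlgebra.ι ℂ 0 * FreeAlgebra.ι ℂ 2))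
  | db : SLqRel q (FreeAlgebra.ι ℂ 3 * FreeAlgebra.ι ℂ 1)
      (q • (FreeAlgebra.ι ℂ 1 * FreeAlgebra.ι ℂ 3))
  | dc : SLqRel q (FreeAlgebra.ι ℂ 3 * FreeAlgebra.ι ℂ 2)
      (q • (FreeAlgebra.ι ℂ 2 * FreeAlgebra.ι ℂ 3))
  | bc : SLqRel q (FreeAlgebra.ι ℂ 1 * FreeAlgebra.ι ℂ 2)
      (FreeAlgebra.ι ℂ 2 * FreeAlgebra.ι ℂ 1)
  | comm_ad : SLqRel q (FreeAlgebra.ι ℂ 0 * FreeAlgebra.ι ℂ 3 -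
      FreeAlgebra.ι ℂ 3 * FreeAlgebra.ι ℂ 0)
      ((q⁻¹ - q) • (FreeAlgebra.ι ℂ 1 * FreeAlgebra.ι ℂ 2))
  | det : SLqRel q (FreeAlgebra.ι ℂ 0 * FreeAlgebra.ι ℂ 3 -
      q⁻¹ • (FreeAlgebra.ι ℂ 1 * FreeAlgebra.ι ℂ 2)) 1

/-- The quantum coordinate algebra `SL_q(2)`. -/
abbrev SLq2 (q : ℂ) : Type := RingQuot (SLqRel q)

/-- The generator `a` of `SL_q(2)`. -/
noncomputable def sla (q : ℂ) : SLq2 q := RingQuot.mkAlgHom ℂ (SLqRel q) (FreeAlgebra.ι ℂ 0)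
/-- The generator `b` of `SL_q(2)`. -/
noncomputable def slb (q : ℂ) : SLq2 q := RingQuot.mkAlgHom ℂ (SLqRel q) (FreeAlgebra.ι ℂ 1)
/-- The generator `c` of `SL_q(2)`. -/
noncomputable def slc (q : ℂ) : SLq2 q := RingQuot.mkAlgHom ℂ (SLqRel q) (FreeAlgebra.ι ℂ 2)
/-- The generator `d` of `SL_q(2)`. -/
noncomputable def sld (q : ℂ) : SLq2 q := RingQuot.mkAlgHom ℂ (SLqRel q) (FreeAlgebra.ι ℂ 3)

namespace SLq2

/-- The relations of `SL_q(2)`, in normal-form order, for four elements of a `ℂ`-algebra. -/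
structure Relations {R : Type*} [Ring R] [Algebra ℂ R] (q : ℂ) (a b c d : R) : Prop where
  ba : b * a = q • (a * b)
  ca : c * a = q • (a * c)
  db : d * b = q • (b * d)
  dc : d * c = q • (c * d)
  cb : c * b = b * c
  ad : a * d = 1 + q⁻¹ • (b * c)
  da : d * a = 1 + q • (b * c)

theorem relations_generators (q : ℂ) : Relations q (sla q) (slb q) (slc q) (sld q) := by
  have h {x y} (hxy : SLqRel q x y) := RingQuot.mkAlgHom_rel ℂ hxy
  have had : sla q * sld q = 1 + q⁻¹ • (slb q * slc q) := by
    have := h .det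
    simp only [map_sub, map_mul, map_smul, map_one] at this
    exact sub_eq_iff_eq_add.mp this
  refine ⟨?_, ?_, ?_, ?_, ?_, had, ?_⟩
  · simpa only [map_mul, map_smul, sla, slb, slc, sld] using h .ba
  · simpa only [map_mul, map_smul, sla, slb, slc, sld] using h .ca
  · simpa only [map_mul, map_smul, sla, slb, slc, sld] using h .db
  · simpa only [map_mul, map_smul, sla, slb, slc, sld] using h .dc
  · simpa only [map_mul, sla, slb, slc, sld] using (h .bc).symm
  · have : sla q * sld q - sld q * sla q = (q⁻¹ - q) • (slb q * slc q) := by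
      simpa only [map_sub, map_mul, map_smul, sla, slb, slc, sld] using h .comm_ad
    rw [had] at this
    rw [← sub_eq_iff_eq_add.mpr (sub_eq_iff_eq_add'.mp this)]
    module

/-- Four elements satisfying the relations of `SL_q(2)` define a morphism out of it. -/
theorem exists_algHom {R : Type*} [Ring R] [Algebra ℂ R] {q : ℂ} {a b c d : R}
    (h : Relations q a b c d) :
    ∃ f : SLq2 q →ₐ[ℂ] R, f (sla q) = a ∧ f (slb q) = b ∧ f (slc q) = c ∧ f (sld q) = d := by
  have hrel : ∀ ⦃x y⦄, SLqRel q x y →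
      FreeAlgebra.lift ℂ ![a, b, c, d] x = FreeAlgebra.lift ℂ ![a, b, c, d] y := by
    intro x y hxy
    cases hxy <;>
      simp [h.ba, h.ca, h.db, h.dc, h.cb, h.ad, h.da]
    module
  refine ⟨RingQuot.liftAlgHom ℂ ⟨FreeAlgebra.lift ℂ ![a, b, c, d], hrel⟩, ?_, ?_, ?_, ?_⟩ <;>
    simp [sla, slb, slc, sld]

theorem algHom_ext {R : Type*} [Semiring R] [Algebra ℂ R] {q : ℂ} {f g : SLq2 q →ₐ[ℂ] R}
    (ha : f (sla q) = g (sla q)) (hb : f (slb q) = g (slb q))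
    (hc : f (slc q) = g (slc q)) (hd : f (sld q) = g (sld q)) : f = g := by
  apply RingQuot.ringQuot_ext'
  apply FreeAlgebra.hom_ext
  funext i
  fin_cases i
  exacts [ha, hb, hc, hd]

theorem induction {q : ℂ} {P : SLq2 q → Prop} (hr : ∀ r : ℂ, P (algebraMap ℂ _ r))
    (ha : P (sla q)) (hb : P (slb q)) (hc : P (slc q)) (hd : P (sld q))
    (hadd : ∀ x y, P x → P y → P (x + y)) (hmul : ∀ x y, P x → P y → P (x * y))
    (x : SLq2 q) : P x := by
  obtain ⟨x, rfl⟩ := RingQuot.mkAlgHom_surjective ℂ (SLqRel q) x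
  induction x using FreeAlgebra.induction with
  | grade0 r => simpa only [AlgHom.commutes] using hr r
  | grade1 i =>
    fin_cases i
    exacts [ha, hb, hc, hd]
  | mul x y hx hy => simpa only [map_mul] using hmul _ _ hx hy
  | add x y hx hy => simpa only [map_add] using hadd _ _ hx hy

/-- The entries of the product of two quantum matrices with mutually commuting entries
satisfy the relations again. -/
theorem Relations.tmul {A B : Type*} [Ring A] [Algebra ℂ A] [Ring B] [Algebra ℂ B] {q : ℂ}
    (hq : q ≠ 0) {a b c d : A} {a' b' c' d' : B} (h : Relations q a b c d)
    (h' : Relations q a' b' c' d') :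
    Relations q (a ⊗ₜ[ℂ] a' + b ⊗ₜ[ℂ] c') (a ⊗ₜ[ℂ] b' + b ⊗ₜ[ℂ] d')
      (c ⊗ₜ[ℂ] a' + d ⊗ₜ[ℂ] c') (c ⊗ₜ[ℂ] b' + d ⊗ₜ[ℂ] d') := by
  constructor <;>
    simp only [add_mul, mul_add, Algebra.TensorProduct.tmul_mul_tmul, h.ba, h.ca, h.db, h.dc,
      h.cb, h.ad, h.da, h'.ba, h'.ca, h'.db, h'.dc, h'.cb, h'.ad, h'.da, tmul_add, add_tmul,
      tmul_smul, ← smul_tmul', Algebra.TensorProduct.one_def] <;>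
    match_scalars <;> field_simp

theorem Relations.antipode {R : Type*} [Ring R] [Algebra ℂ R] {q : ℂ} (hq : q ≠ 0)
    {a b c d : R} (h : Relations q a b c d) :
    Relations q (MulOpposite.op d) (MulOpposite.op (-(q • b))) (MulOpposite.op (-(q⁻¹ • c)))
      (MulOpposite.op a) := by
  constructor <;>
    simp only [← MulOpposite.op_mul, ← MulOpposite.op_smul, ← MulOpposite.op_one,
      ← MulOpposite.op_add] <;>
    congr 1 <;>
    simp only [neg_mul, mul_neg, smul_mul_assoc, mul_smul_comm, h.ba, h.ca, h.db, h.dc, h.cb,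
      h.ad, h.da] <;>
    match_scalars <;> field_simp

/-- The antipode equations `S(M) M = 1` on the matrix of generators. -/
theorem Relations.antipode_mul {R : Type*} [Ring R] [Algebra ℂ R] {q : ℂ} (hq : q ≠ 0)
    {a b c d : R} (h : Relations q a b c d) :
    d * a + -(q • b) * c = 1 ∧ d * b + -(q • b) * d = 0 ∧
      -(q⁻¹ • c) * a + a * c = 0 ∧ -(q⁻¹ • c) * b + a * d = 1 := by
  simp [h.da, h.db, h.ca, h.ad, h.cb, hq]

/-- The antipode equations `M S(M) = 1` on the matrix of generators. -/
theorem Relations.mul_antipode {R : Type*} [Ring R] [Algebra ℂ R] {q : ℂ} (hq : q ≠ 0)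
    {a b c d : R} (h : Relations q a b c d) :
    a * d + b * -(q⁻¹ • c) = 1 ∧ a * -(q • b) + b * a = 0 ∧
      c * d + d * -(q⁻¹ • c) = 0 ∧ c * -(q • b) + d * a = 1 := by
  simp [h.ad, h.ba, h.dc, h.da, h.cb, hq]

section Convolution

variable {A : Type*} [Ring A] [Algebra ℂ A] {S : A →ₗ[ℂ] A}

theorem mul'_rTensor_mul_of_eq_algebraMap (hS : ∀ x y, S (x * y) = S y * S x) {t : A ⊗[ℂ] A}
    {r : ℂ} (ht : LinearMap.mul' ℂ A (S.rTensor A t) = algebraMap ℂ A r) (u : A ⊗[ℂ] A) :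
    LinearMap.mul' ℂ A (S.rTensor A (t * u)) = r • LinearMap.mul' ℂ A (S.rTensor A u) := by
  induction u with
  | zero => simp
  | add u v hu hv => simp only [mul_add, map_add, smul_add, hu, hv]
  | tmul u v =>
    have key : LinearMap.mul' ℂ A (S.rTensor A (t * u ⊗ₜ v)) =
        S u * LinearMap.mul' ℂ A (S.rTensor A t) * v := by
      clear ht
      induction t with
      | zero => simp
      | add s t hs ht => simp only [add_mul, mul_add, map_add, hs, ht]
      | tmul s t => simp [hS, mul_assoc]
    rw [key, ht, ← Algebra.commutes, mul_assoc, ← Algebra.smul_def]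
    simp

theorem mul'_lTensor_mul_of_eq_algebraMap (hS : ∀ x y, S (x * y) = S y * S x) (t : A ⊗[ℂ] A)
    {u : A ⊗[ℂ] A} {r : ℂ} (hu : LinearMap.mul' ℂ A (S.lTensor A u) = algebraMap ℂ A r) :
    LinearMap.mul' ℂ A (S.lTensor A (t * u)) = r • LinearMap.mul' ℂ A (S.lTensor A t) := by
  induction t with
  | zero => simp
  | add s t hs ht => simp only [add_mul, map_add, smul_add, hs, ht]
  | tmul s t =>
    have key : LinearMap.mul' ℂ A (S.lTensor A (s ⊗ₜ t * u)) =
        s * LinearMap.mul' ℂ A (S.lTensor A u) * S t := by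
      clear hu
      induction u with
      | zero => simp
      | add u v hu hv => simp only [add_mul, mul_add, map_add, hu, hv]
      | tmul u v => simp [hS, mul_assoc]
    rw [key, hu, ← Algebra.commutes, mul_assoc, ← Algebra.smul_def]
    simp

end Convolution

/-- The antipode as an anti-multiplicative linear map. -/
theorem exists_antipode {q : ℂ} (hq : q ≠ 0) :
    ∃ S : SLq2 q →ₗ[ℂ] SLq2 q, S 1 = 1 ∧ (∀ x y, S (x * y) = S y * S x) ∧
      S (sla q) = sld q ∧ S (slb q) = -(q • slb q) ∧
      S (slc q) = -(q⁻¹ • slc q) ∧ S (sld q) = sla q := by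
  obtain ⟨f, ha, hb, hc, hd⟩ := exists_algHom ((relations_generators q).antipode hq)
  refine ⟨(MulOpposite.opLinearEquiv ℂ).symm.toLinearMap ∘ₗ f.toLinearMap, ?_, ?_, ?_, ?_, ?_, ?_⟩
  · simp
  · simp
  · simp [ha]
  · simp [hb]
  · simp [hc]
  · simp [hd]

end SLq2

/-- Let `q ≠ 0`. The algebra `SL_q(2)` is a Hopf algebra: there are unique
algebra morphisms `Δ` and `ε` taking the prescribed values on `a, b, c, d`; `Δ` is
coassociative with counit `ε`; and there is a linear map `S` with the prescribed values on
the generators satisfying the antipode equations `μ∘(S⊗id)∘Δ = η∘ε = μ∘(id⊗S)∘Δ`. -/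
theorem SLq2_hopfAlgebra (q : ℂ) (hq : q ≠ 0) :
    (∃! Δ : SLq2 q →ₐ[ℂ] SLq2 q ⊗[ℂ] SLq2 q,
      Δ (sla q) = sla q ⊗ₜ[ℂ] sla q + slb q ⊗ₜ[ℂ] slc q ∧
      Δ (slb q) = sla q ⊗ₜ[ℂ] slb q + slb q ⊗ₜ[ℂ] sld q ∧
      Δ (slc q) = slc q ⊗ₜ[ℂ] sla q + sld q ⊗ₜ[ℂ] slc q ∧
      Δ (sld q) = slc q ⊗ₜ[ℂ] slb q + sld q ⊗ₜ[ℂ] sld q) ∧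
    (∃! ε : SLq2 q →ₐ[ℂ] ℂ,
      ε (sla q) = 1 ∧ ε (slb q) = 0 ∧ ε (slc q) = 0 ∧ ε (sld q) = 1) ∧
    (∀ (Δ : SLq2 q →ₐ[ℂ] SLq2 q ⊗[ℂ] SLq2 q) (ε : SLq2 q →ₐ[ℂ] ℂ),
      (Δ (sla q) = sla q ⊗ₜ[ℂ] sla q + slb q ⊗ₜ[ℂ] slc q ∧
       Δ (slb q) = sla q ⊗ₜ[ℂ] slb q + slb q ⊗ₜ[ℂ] sld q ∧
       Δ (slc q) = slc q ⊗ₜ[ℂ] sla q + sld q ⊗ₜ[ℂ] slc q ∧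
       Δ (sld q) = slc q ⊗ₜ[ℂ] slb q + sld q ⊗ₜ[ℂ] sld q) →
      (ε (sla q) = 1 ∧ ε (slb q) = 0 ∧ ε (slc q) = 0 ∧ ε (sld q) = 1) →
      -- `Δ` is coassociative: `(Δ ⊗ id) ∘ Δ = (id ⊗ Δ) ∘ Δ`
      ((TensorProduct.assoc ℂ (SLq2 q) (SLq2 q) (SLq2 q)).toLinearMap ∘ₗ
          Δ.toLinearMap.rTensor (SLq2 q) ∘ₗ Δ.toLinearMap
        = Δ.toLinearMap.lTensor (SLq2 q) ∘ₗ Δ.toLinearMap) ∧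
      -- `ε` is a counit for `Δ`: `(ε ⊗ id) ∘ Δ = id = (id ⊗ ε) ∘ Δ`
      ((TensorProduct.lid ℂ (SLq2 q)).toLinearMap ∘ₗ
          (ε.toLinearMap.rTensor (SLq2 q)) ∘ₗ Δ.toLinearMap = LinearMap.id) ∧
      ((TensorProduct.rid ℂ (SLq2 q)).toLinearMap ∘ₗ
          (ε.toLinearMap.lTensor (SLq2 q)) ∘ₗ Δ.toLinearMap = LinearMap.id) ∧
      -- there is an antipode `S` with the prescribed values on the generators
      (∃ S : SLq2 q →ₗ[ℂ] SLq2 q,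
        S (sla q) = sld q ∧ S (slb q) = -(q • slb q) ∧
        S (slc q) = -(q⁻¹ • slc q) ∧ S (sld q) = sla q ∧
        LinearMap.mul' ℂ (SLq2 q) ∘ₗ S.rTensor (SLq2 q) ∘ₗ Δ.toLinearMap
          = Algebra.linearMap ℂ (SLq2 q) ∘ₗ ε.toLinearMap ∧
        LinearMap.mul' ℂ (SLq2 q) ∘ₗ S.lTensor (SLq2 q) ∘ₗ Δ.toLinearMap
          = Algebra.linearMap ℂ (SLq2 q) ∘ₗ ε.toLinearMap)) := by
  have h := SLq2.relations_generators q
  refine ⟨?_, ?_, ?_⟩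
  · obtain ⟨Δ, ha, hb, hc, hd⟩ := SLq2.exists_algHom (h.tmul hq h)
    refine ⟨Δ, ⟨ha, hb, hc, hd⟩, ?_⟩
    rintro Δ' ⟨ha', hb', hc', hd'⟩
    exact SLq2.algHom_ext (ha'.trans ha.symm) (hb'.trans hb.symm) (hc'.trans hc.symm)
      (hd'.trans hd.symm)
  · have hε : SLq2.Relations q (1 : ℂ) 0 0 1 := by constructor <;> simp
    obtain ⟨ε, ha, hb, hc, hd⟩ := SLq2.exists_algHom hε
    refine ⟨ε, ⟨ha, hb, hc, hd⟩, ?_⟩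
    rintro ε' ⟨ha', hb', hc', hd'⟩
    exact SLq2.algHom_ext (ha'.trans ha.symm) (hb'.trans hb.symm) (hc'.trans hc.symm)
      (hd'.trans hd.symm)
  · rintro Δ ε ⟨Δa, Δb, Δc, Δd⟩ ⟨εa, εb, εc, εd⟩
    refine ⟨?_, ?_, ?_, ?_⟩
    · have : ((Algebra.TensorProduct.assoc ℂ ℂ ℂ (SLq2 q) (SLq2 q) (SLq2 q)).toAlgHom.comp
          (Algebra.TensorProduct.map Δ (AlgHom.id ℂ (SLq2 q)))).comp Δ =
          (Algebra.TensorProduct.map (AlgHom.id ℂ (SLq2 q)) Δ).comp Δ := by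
        apply SLq2.algHom_ext <;>
          simp [Δa, Δb, Δc, Δd, add_tmul, tmul_add] <;> abel
      exact congrArg AlgHom.toLinearMap this
    · have : ((Algebra.TensorProduct.lid ℂ (SLq2 q)).toAlgHom.comp
          (Algebra.TensorProduct.map ε (AlgHom.id ℂ (SLq2 q)))).comp Δ = AlgHom.id ℂ _ := by
        apply SLq2.algHom_ext <;> simp [Δa, Δb, Δc, Δd, εa, εb, εc, εd]
      exact congrArg AlgHom.toLinearMap this
    · have : ((Algebra.TensorProduct.rid ℂ ℂ (SLq2 q)).toAlgHom.comp
          (Algebra.TensorProduct.map (AlgHom.id ℂ (SLq2 q)) ε)).comp Δ = AlgHom.id ℂ _ := by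
        apply SLq2.algHom_ext <;> simp [Δa, Δb, Δc, Δd, εa, εb, εc, εd]
      exact congrArg AlgHom.toLinearMap this
    · obtain ⟨S, S1, Smul, Sa, Sb, Sc, Sd⟩ := SLq2.exists_antipode hq
      refine ⟨S, Sa, Sb, Sc, Sd, LinearMap.ext fun x => ?_, LinearMap.ext fun x => ?_⟩ <;>
        simp only [LinearMap.comp_apply, AlgHom.toLinearMap_apply, Algebra.linearMap_apply]
      · obtain ⟨ha', hb', hc', hd'⟩ := h.antipode_mul hq
        induction x using SLq2.induction with
        | hr r => simp [Algebra.algebraMap_eq_smul_one, S1, Algebra.TensorProduct.one_def]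
        | ha => simpa only [Δa, εa, Sa, Sb, map_add, map_one, map_zero, LinearMap.rTensor_tmul,
            LinearMap.mul'_apply] using ha'
        | hb => simpa only [Δb, εb, Sa, Sb, map_add, map_one, map_zero, LinearMap.rTensor_tmul,
            LinearMap.mul'_apply] using hb'
        | hc => simpa only [Δc, εc, Sc, Sd, map_add, map_one, map_zero, LinearMap.rTensor_tmul,
            LinearMap.mul'_apply] using hc'
        | hd => simpa only [Δd, εd, Sc, Sd, map_add, map_one, map_zero, LinearMap.rTensor_tmul,
            LinearMap.mul'_apply] using hd'
        | hadd x y hx hy => simp only [map_add, hx, hy]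
        | hmul x y hx hy =>
          rw [map_mul, SLq2.mul'_rTensor_mul_of_eq_algebraMap Smul hx, hy, map_mul, map_mul,
            Algebra.smul_def]
      · obtain ⟨ha', hb', hc', hd'⟩ := h.mul_antipode hq
        induction x using SLq2.induction with
        | hr r => simp [Algebra.algebraMap_eq_smul_one, S1, Algebra.TensorProduct.one_def]
        | ha => simpa only [Δa, εa, Sa, Sc, map_add, map_one, map_zero, LinearMap.lTensor_tmul,
            LinearMap.mul'_apply] using ha'
        | hb => simpa only [Δb, εb, Sb, Sd, map_add, map_one, map_zero, LinearMap.lTensor_tmul,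
            LinearMap.mul'_apply] using hb'
        | hc => simpa only [Δc, εc, Sa, Sc, map_add, map_one, map_zero, LinearMap.lTensor_tmul,
            LinearMap.mul'_apply] using hc'
        | hd => simpa only [Δd, εd, Sb, Sd, map_add, map_one, map_zero, LinearMap.lTensor_tmul,
            LinearMap.mul'_apply] using hd'
        | hadd x y hx hy => simp only [map_add, hx, hy]
        | hmul x y hx hy =>
          rw [map_mul, SLq2.mul'_lTensor_mul_of_eq_algebraMap Smul _ hy, hx, map_mul, map_mul,
            Algebra.commutes, Algebra.smul_def]
end

section
/- Let q be a nonzero complex number. There is a unique algebra morphism δ : ℂ_q[X,Y] → ℂ_q[X,Y] ⊗ SL_q(2) with δ(X) = X ⊗ a + Y ⊗ c and δ(Y) = X ⊗ b + Y ⊗ d, and δ satisfies (δ ⊗ id)∘δ = (id ⊗ Δ)∘δ and (id ⊗ ε)∘δ = id, where Δ and ε are the coproduct and counit of SL_q(2); thus the quantum plane ℂ_q[X,Y] is an SL_q(2)-comodule algebra. -/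
open TensorProduct

/-- The defining relation `Y X = q (X Y)` of the quantum plane, on the free algebra over `ℂ`
on two generators `X = ι 0` and `Y = ι 1`. -/
inductive QuantumPlaneRel (q : ℂ) : FreeAlgebra ℂ (Fin 2) → FreeAlgebra ℂ (Fin 2) → Prop
  | comm : QuantumPlaneRel q (FreeAlgebra.ι ℂ 1 * FreeAlgebra.ι ℂ 0)
      (q • (FreeAlgebra.ι ℂ 0 * FreeAlgebra.ι ℂ 1))

/-- The quantum plane `ℂ_q[X,Y]`. -/
abbrev QuantumPlane (q : ℂ) : Type := RingQuot (QuantumPlaneRel q)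

/-- The image of the generator `X` in the quantum plane. -/
noncomputable def qpX (q : ℂ) : QuantumPlane q :=
  RingQuot.mkAlgHom ℂ (QuantumPlaneRel q) (FreeAlgebra.ι ℂ 0)

/-- The image of the generator `Y` in the quantum plane. -/
noncomputable def qpY (q : ℂ) : QuantumPlane q :=
  RingQuot.mkAlgHom ℂ (QuantumPlaneRel q) (FreeAlgebra.ι ℂ 1)

theorem qpY_mul_qpX (q : ℂ) : qpY q * qpX q = q • (qpX q * qpY q) := by
  simpa only [qpX, qpY, map_mul, map_smul] using
    RingQuot.mkAlgHom_rel ℂ (QuantumPlaneRel.comm (q := q))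

theorem slb_mul_sla (q : ℂ) : slb q * sla q = q • (sla q * slb q) := by
  simpa only [sla, slb, map_mul, map_smul] using RingQuot.mkAlgHom_rel ℂ (SLqRel.ba (q := q))

theorem sld_mul_slc (q : ℂ) : sld q * slc q = q • (slc q * sld q) := by
  simpa only [slc, sld, map_mul, map_smul] using RingQuot.mkAlgHom_rel ℂ (SLqRel.dc (q := q))

theorem slb_mul_slc (q : ℂ) : slb q * slc q = slc q * slb q := by
  simpa only [slb, slc, map_mul] using RingQuot.mkAlgHom_rel ℂ (SLqRel.bc (q := q))

theorem sla_mul_sld_sub (q : ℂ) :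
    sla q * sld q - sld q * sla q = (q⁻¹ - q) • (slb q * slc q) := by
  simpa only [sla, slb, slc, sld, map_mul, map_smul, map_sub] using
    RingQuot.mkAlgHom_rel ℂ (SLqRel.comm_ad (q := q))

/-- The universal property of the quantum plane: a pair `x`, `y` with `y x = q (x y)` defines an
algebra morphism. -/
noncomputable def quantumPlaneLift {A : Type*} [Semiring A] [Algebra ℂ A] (q : ℂ) (x y : A)
    (h : y * x = q • (x * y)) : QuantumPlane q →ₐ[ℂ] A :=
  RingQuot.liftAlgHom ℂ ⟨FreeAlgebra.lift ℂ ![x, y], by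
    rintro _ _ ⟨⟩
    simpa using h⟩

theorem quantumPlaneLift_qpX {A : Type*} [Semiring A] [Algebra ℂ A] (q : ℂ) (x y : A)
    (h : y * x = q • (x * y)) : quantumPlaneLift q x y h (qpX q) = x := by
  simp [quantumPlaneLift, qpX]

theorem quantumPlaneLift_qpY {A : Type*} [Semiring A] [Algebra ℂ A] (q : ℂ) (x y : A)
    (h : y * x = q • (x * y)) : quantumPlaneLift q x y h (qpY q) = y := by
  simp [quantumPlaneLift, qpY]

theorem quantumPlane_algHom_ext {A : Type*} [Semiring A] [Algebra ℂ A] {q : ℂ}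
    {f g : QuantumPlane q →ₐ[ℂ] A} (hX : f (qpX q) = g (qpX q)) (hY : f (qpY q) = g (qpY q)) :
    f = g := by
  apply RingQuot.ringQuot_ext'
  apply FreeAlgebra.hom_ext
  funext i
  fin_cases i
  · exact hX
  · exact hY

/-- The images of `X` and `Y` under the coaction satisfy the relation of the quantum plane. -/
theorem coaction_relation (q : ℂ) (hq : q ≠ 0) :
    (qpX q ⊗ₜ[ℂ] slb q + qpY q ⊗ₜ[ℂ] sld q) * (qpX q ⊗ₜ[ℂ] sla q + qpY q ⊗ₜ[ℂ] slc q) =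
      q • ((qpX q ⊗ₜ[ℂ] sla q + qpY q ⊗ₜ[ℂ] slc q) *
        (qpX q ⊗ₜ[ℂ] slb q + qpY q ⊗ₜ[ℂ] sld q)) := by
  have had : sla q * sld q = sld q * sla q + (q⁻¹ - q) • (slc q * slb q) := by
    rw [← slb_mul_slc, ← sla_mul_sld_sub]
    abel
  simp only [add_mul, mul_add, Algebra.TensorProduct.tmul_mul_tmul, qpY_mul_qpX, slb_mul_sla,
    sld_mul_slc, slb_mul_slc, had, TensorProduct.tmul_add, TensorProduct.tmul_smul,
    ← TensorProduct.smul_tmul', smul_add]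
  match_scalars <;> field_simp
  ring

/-- Let `q ≠ 0`. There is a unique algebra morphism
`δ : ℂ_q[X,Y] → ℂ_q[X,Y] ⊗ SL_q(2)` with `δ(X) = X ⊗ a + Y ⊗ c` and
`δ(Y) = X ⊗ b + Y ⊗ d`, and `δ` satisfies `(δ ⊗ id) ∘ δ = (id ⊗ Δ) ∘ δ` and
`(id ⊗ ε) ∘ δ = id`; thus the quantum plane is an `SL_q(2)`-comodule algebra. -/
theorem quantumPlane_comodule_algebra (q : ℂ) (hq : q ≠ 0)
    -- the coproduct and counit of `SL_q(2)`
    (Δ : SLq2 q →ₐ[ℂ] SLq2 q ⊗[ℂ] SLq2 q)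
    (hΔ : Δ (sla q) = sla q ⊗ₜ[ℂ] sla q + slb q ⊗ₜ[ℂ] slc q ∧
      Δ (slb q) = sla q ⊗ₜ[ℂ] slb q + slb q ⊗ₜ[ℂ] sld q ∧
      Δ (slc q) = slc q ⊗ₜ[ℂ] sla q + sld q ⊗ₜ[ℂ] slc q ∧
      Δ (sld q) = slc q ⊗ₜ[ℂ] slb q + sld q ⊗ₜ[ℂ] sld q)
    (ε : SLq2 q →ₐ[ℂ] ℂ)
    (hε : ε (sla q) = 1 ∧ ε (slb q) = 0 ∧ ε (slc q) = 0 ∧ ε (sld q) = 1) :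
    (∃! δ : QuantumPlane q →ₐ[ℂ] QuantumPlane q ⊗[ℂ] SLq2 q,
      δ (qpX q) = qpX q ⊗ₜ[ℂ] sla q + qpY q ⊗ₜ[ℂ] slc q ∧
      δ (qpY q) = qpX q ⊗ₜ[ℂ] slb q + qpY q ⊗ₜ[ℂ] sld q) ∧
    (∀ δ : QuantumPlane q →ₐ[ℂ] QuantumPlane q ⊗[ℂ] SLq2 q,
      (δ (qpX q) = qpX q ⊗ₜ[ℂ] sla q + qpY q ⊗ₜ[ℂ] slc q ∧
       δ (qpY q) = qpX q ⊗ₜ[ℂ] slb q + qpY q ⊗ₜ[ℂ] sld q) →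
      -- `(δ ⊗ id) ∘ δ = (id ⊗ Δ) ∘ δ`
      (δ.toLinearMap.rTensor (SLq2 q) ∘ₗ δ.toLinearMap
        = (TensorProduct.assoc ℂ (QuantumPlane q) (SLq2 q) (SLq2 q)).symm.toLinearMap ∘ₗ
            LinearMap.lTensor (QuantumPlane q) Δ.toLinearMap ∘ₗ δ.toLinearMap) ∧
      -- `(id ⊗ ε) ∘ δ = id`
      ((TensorProduct.rid ℂ (QuantumPlane q)).toLinearMap ∘ₗ
          LinearMap.lTensor (QuantumPlane q) ε.toLinearMap ∘ₗ δ.toLinearMap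
        = LinearMap.id)) := by
  obtain ⟨hΔa, hΔb, hΔc, hΔd⟩ := hΔ
  obtain ⟨hεa, hεb, hεc, hεd⟩ := hε
  refine ⟨⟨quantumPlaneLift q _ _ (coaction_relation q hq),
    ⟨quantumPlaneLift_qpX .., quantumPlaneLift_qpY ..⟩, ?_⟩, ?_⟩
  · rintro δ ⟨hX, hY⟩
    apply quantumPlane_algHom_ext
    · rw [hX, quantumPlaneLift_qpX]
    · rw [hY, quantumPlaneLift_qpY]
  · rintro δ ⟨hX, hY⟩
    constructor
    · have h : (Algebra.TensorProduct.map δ (AlgHom.id ℂ (SLq2 q))).comp δ =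
          ((Algebra.TensorProduct.assoc ℂ ℂ ℂ (QuantumPlane q) (SLq2 q)
            (SLq2 q)).symm.toAlgHom.comp
              (Algebra.TensorProduct.map (AlgHom.id ℂ (QuantumPlane q)) Δ)).comp δ := by
        apply quantumPlane_algHom_ext
        · simp [hX, hY, hΔa, hΔc, TensorProduct.add_tmul, TensorProduct.tmul_add]
          abel
        · simp [hX, hY, hΔb, hΔd, TensorProduct.add_tmul, TensorProduct.tmul_add]
          abel
      exact congrArg AlgHom.toLinearMap h
    · have h : ((Algebra.TensorProduct.rid ℂ ℂ (QuantumPlane q)).toAlgHom.comp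
          (Algebra.TensorProduct.map (AlgHom.id ℂ (QuantumPlane q)) ε)).comp δ =
            AlgHom.id ℂ (QuantumPlane q) := by
        apply quantumPlane_algHom_ext
        · simp [hX, hεa, hεc]
        · simp [hY, hεb, hεd]
      exact congrArg AlgHom.toLinearMap h
end

section
/- Let q be a nonzero complex number and δ : ℂ_q[X,Y] → ℂ_q[X,Y] ⊗ SL_q(2) the coaction with δ(X) = X ⊗ a + Y ⊗ c and δ(Y) = X ⊗ b + Y ⊗ d. Then the subalgebra of coinvariants of the quantum plane is trivial: if ω ∈ ℂ_q[X,Y] satisfies δ(ω) = ω ⊗ 1, then ω is a scalar multiple of the unit 1; i.e. ℂ_q[X,Y]^{co-SL_q(2)} = ℂ·1. -/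
open TensorProduct

/-- A property of elements of the quantum plane that holds for scalars and for the generators, and
is stable under sums and products, holds everywhere. -/
theorem QuantumPlane.induction {q : ℂ} {P : QuantumPlane q → Prop}
    (algebraMap : ∀ r : ℂ, P (algebraMap ℂ (QuantumPlane q) r))
    (X : P (qpX q)) (Y : P (qpY q))
    (mul : ∀ u v, P u → P v → P (u * v)) (add : ∀ u v, P u → P v → P (u + v))
    (w : QuantumPlane q) : P w := by
  obtain ⟨x, rfl⟩ := RingQuot.mkAlgHom_surjective ℂ (QuantumPlaneRel q) w
  induction x using FreeAlgebra.induction with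
  | grade0 r => rw [AlgHom.commutes]; exact algebraMap r
  | grade1 i => fin_cases i <;> assumption
  | mul u v hu hv => rw [map_mul]; exact mul _ _ hu hv
  | add u v hu hv => rw [map_add]; exact add _ _ hu hv

theorem qpY_mul_qpX_pow (q : ℂ) (i : ℕ) :
    qpY q * qpX q ^ i = q ^ i • (qpX q ^ i * qpY q) := by
  induction i with
  | zero => simp
  | succ i ih =>
    rw [pow_succ, ← mul_assoc, ih, smul_mul_assoc, mul_assoc, qpY_mul_qpX, mul_smul_comm,
      smul_smul, ← pow_succ, mul_assoc]

/-- The ordered monomials `X ^ i * Y ^ j` span the quantum plane. -/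
theorem span_range_qpX_pow_mul_qpY_pow (q : ℂ) :
    Submodule.span ℂ (Set.range fun p : ℕ × ℕ => qpX q ^ p.1 * qpY q ^ p.2) = ⊤ := by
  set S := Submodule.span ℂ (Set.range fun p : ℕ × ℕ => qpX q ^ p.1 * qpY q ^ p.2)
  have mem (i j : ℕ) : qpX q ^ i * qpY q ^ j ∈ S := Submodule.subset_span ⟨(i, j), rfl⟩
  have stable (w : QuantumPlane q) : S ≤ S.comap (LinearMap.mulLeft ℂ w) := by
    induction w using QuantumPlane.induction with
    | algebraMap r =>
      intro s hs
      simpa [← Algebra.smul_def] using S.smul_mem r hs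
    | X =>
      refine Submodule.span_le.2 ?_
      rintro _ ⟨⟨i, j⟩, rfl⟩
      simpa [← mul_assoc, ← pow_succ'] using mem (i + 1) j
    | Y =>
      refine Submodule.span_le.2 ?_
      rintro _ ⟨⟨i, j⟩, rfl⟩
      simpa [← mul_assoc, qpY_mul_qpX_pow, mul_assoc _ (qpY q), ← pow_succ'] using
        S.smul_mem (q ^ i) (mem i (j + 1))
    | mul u v hu hv =>
      intro s hs
      simpa [mul_assoc] using hu (hv hs)
    | add u v hu hv =>
      intro s hs
      simpa [add_mul] using S.add_mem (hu hs) (hv hs)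
  refine eq_top_iff.2 fun w _ => ?_
  have one_mem : (1 : QuantumPlane q) ∈ S := by simpa using mem 0 0
  simpa using stable w one_mem

/-- The character of the quantum plane with `X ↦ 1` and `Y ↦ 0`. -/
noncomputable def qpCharacter (q : ℂ) : QuantumPlane q →ₐ[ℂ] ℂ :=
  RingQuot.liftAlgHom ℂ ⟨FreeAlgebra.lift ℂ ![1, 0], by rintro _ _ ⟨⟩; simp⟩

@[simp] theorem qpCharacter_qpX (q : ℂ) : qpCharacter q (qpX q) = 1 := by
  simp [qpCharacter, qpX]

@[simp] theorem qpCharacter_qpY (q : ℂ) : qpCharacter q (qpY q) = 0 := by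
  simp [qpCharacter, qpY]

/-- The translation `e (i, j) ↦ e (i + n, j)`. -/
noncomputable def borelShift (n : ℤ) : Module.End ℂ (ℤ × ℕ →₀ ℂ) :=
  Finsupp.lmapDomain ℂ ℂ fun p => (p.1 + n, p.2)

/-- The operator `e (i, j) ↦ q ^ i • e (i, j + 1)`. -/
noncomputable def borelRaise (q : ℂ) : Module.End ℂ (ℤ × ℕ →₀ ℂ) :=
  Finsupp.lsum ℂ fun p => q ^ p.1 • Finsupp.lsingle (p.1, p.2 + 1)

@[simp] theorem borelShift_single (n : ℤ) (p : ℤ × ℕ) (r : ℂ) :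
    borelShift n (Finsupp.single p r) = Finsupp.single (p.1 + n, p.2) r := by
  simp [borelShift]

@[simp] theorem borelRaise_single (q : ℂ) (p : ℤ × ℕ) (r : ℂ) :
    borelRaise q (Finsupp.single p r) = Finsupp.single (p.1, p.2 + 1) (q ^ p.1 * r) := by
  simp [borelRaise]

theorem borelRaise_mul_borelShift {q : ℂ} (hq : q ≠ 0) (n : ℤ) :
    borelRaise q * borelShift n = q ^ n • (borelShift n * borelRaise q) := by
  refine Finsupp.lhom_ext fun p r => ?_
  simp [zpow_add₀ hq, mul_comm (q ^ p.1), mul_assoc, -Finsupp.single_mul]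

theorem borelShift_mul_borelShift (m n : ℤ) :
    borelShift m * borelShift n = borelShift (n + m) := by
  refine Finsupp.lhom_ext fun p r => ?_
  simp [add_assoc]

theorem borelShift_zero : borelShift 0 = 1 := by
  refine Finsupp.lhom_ext fun p r => ?_
  simp

/-- The regular representation of the quotient of `SL_q(2)` by `c = 0`, in the basis
`e (i, j) = a ^ i * b ^ j`. -/
noncomputable def borelRep {q : ℂ} (hq : q ≠ 0) :
    SLq2 q →ₐ[ℂ] Module.End ℂ (ℤ × ℕ →₀ ℂ) :=
  RingQuot.liftAlgHom ℂ
    ⟨FreeAlgebra.lift ℂ ![borelShift 1, borelRaise q, 0, borelShift (-1)], by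
      rintro _ _ ⟨⟩ <;>
        simp [borelRaise_mul_borelShift hq, borelShift_mul_borelShift, borelShift_zero,
          smul_smul, hq]⟩

@[simp] theorem borelRep_sla {q : ℂ} (hq : q ≠ 0) : borelRep hq (sla q) = borelShift 1 := by
  simp [borelRep, sla]

@[simp] theorem borelRep_slb {q : ℂ} (hq : q ≠ 0) : borelRep hq (slb q) = borelRaise q := by
  simp [borelRep, slb]

theorem borelShift_one_pow_mul_borelRaise_pow_single (q : ℂ) (i j : ℕ) :
    (borelShift 1 ^ i * borelRaise q ^ j) (Finsupp.single (0, 0) 1) =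
      Finsupp.single ((i : ℤ), j) 1 := by
  have raise : (borelRaise q ^ j) (Finsupp.single (0, 0) 1) = Finsupp.single (0, j) 1 := by
    induction j with
    | zero => simp
    | succ j ih => rw [pow_succ', Module.End.mul_apply, ih]; simp
  rw [Module.End.mul_apply, raise]
  induction i with
  | zero => simp
  | succ i ih => rw [pow_succ', Module.End.mul_apply, ih]; simp

/-- The quantum plane embeds into `SL_q(2)` as the subalgebra generated by `a` and `b`. -/
theorem injective_of_map_qpX_of_map_qpY {q : ℂ} (hq : q ≠ 0) (φ : QuantumPlane q →ₐ[ℂ] SLq2 q)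
    (hX : φ (qpX q) = sla q) (hY : φ (qpY q) = slb q) : Function.Injective φ := by
  let ev : SLq2 q →ₗ[ℂ] (ℤ × ℕ →₀ ℂ) :=
    (LinearMap.applyₗ (Finsupp.single (0, 0) 1)).comp (borelRep hq).toLinearMap
  let ψ : (ℤ × ℕ →₀ ℂ) →ₗ[ℂ] QuantumPlane q :=
    Finsupp.linearCombination ℂ fun p => qpX q ^ p.1.toNat * qpY q ^ p.2
  have key : (ψ.comp ev).comp φ.toLinearMap = LinearMap.id := by
    refine LinearMap.ext_on_range (span_range_qpX_pow_mul_qpY_pow q) fun p => ?_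
    have h := borelShift_one_pow_mul_borelRaise_pow_single q p.1 p.2
    rw [Module.End.mul_apply] at h
    simp [ψ, ev, hX, hY, h]
  exact Function.LeftInverse.injective (g := ψ.comp ev) (LinearMap.congr_fun key)

/-- Let `q ≠ 0` and let `δ : ℂ_q[X,Y] → ℂ_q[X,Y] ⊗ SL_q(2)` be the coaction
with `δ(X) = X ⊗ a + Y ⊗ c` and `δ(Y) = X ⊗ b + Y ⊗ d`. Then the coinvariants of the quantum
plane are trivial: if `δ(ω) = ω ⊗ 1` then `ω` is a scalar multiple of `1`. -/
theorem quantumPlane_coinvariants_trivial (q : ℂ) (hq : q ≠ 0)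
    (δ : QuantumPlane q →ₐ[ℂ] QuantumPlane q ⊗[ℂ] SLq2 q)
    (hδX : δ (qpX q) = qpX q ⊗ₜ[ℂ] sla q + qpY q ⊗ₜ[ℂ] slc q)
    (hδY : δ (qpY q) = qpX q ⊗ₜ[ℂ] slb q + qpY q ⊗ₜ[ℂ] sld q)
    (ω : QuantumPlane q) (hω : δ ω = ω ⊗ₜ[ℂ] (1 : SLq2 q)) :
    ∃ c : ℂ, ω = algebraMap ℂ (QuantumPlane q) c := by
  let φ : QuantumPlane q →ₐ[ℂ] SLq2 q :=
    ((Algebra.TensorProduct.lid ℂ (SLq2 q)).toAlgHom.comp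
      (Algebra.TensorProduct.map (qpCharacter q) (AlgHom.id ℂ (SLq2 q)))).comp δ
  have hφ : Function.Injective φ :=
    injective_of_map_qpX_of_map_qpY hq φ (by simp [φ, hδX]) (by simp [φ, hδY])
  refine ⟨qpCharacter q ω, hφ ?_⟩
  rw [AlgHom.commutes, Algebra.algebraMap_eq_smul_one]
  simp [φ, hω]
end
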